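/- Let {(y^k, z^k, x^k)}_{k≥0} be a sequence generated by the majorized iPADMM. For a KKT point ū = (ȳ, z̄, x̄) ∈ Ω̄, define φ_k := (τσ)⁻¹‖x^k − x̄‖² + ‖y^k − ȳ‖²_{Σ̂_f + 𝒮} + ‖z^k − z̄‖²_{Σ̂_g + 𝒯 + σℬℬ*}, and set t_{k+1} := ‖y^{k+1} − y^k‖²_{ℋ_f} + ‖z^{k+1} − z^k‖²_{ℋ_g}. Then for every KKT point ū and every k ≥ 1: [φ_k + (1 − min(τ, τ⁻¹))σ‖r^k‖² + ‖z^k − z^{k−1}‖²_{Σ̂_g + 𝒯}] − [φ_{k+1} + (1 − min(τ, τ⁻¹))σ‖r^{k+1}‖² + ‖z^{k+1} − z^k‖²_{Σ̂_g + 𝒯}] ≥ t_{k+1} + (−τ + min(1 + τ, 1 + τ⁻¹))σ‖r^{k+1}‖². -/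

import Mathlib

open scoped RealInnerProductSpace

noncomputable section

/-- the quadratic form `‖w‖²_M := ⟨w, M w⟩` of a linear operator. -/
def quadForm {E : Type*} [NormedAddCommGroup E] [InnerProductSpace ℝ E]
    (M : E →ₗ[ℝ] E) (w : E) : ℝ := ⟪w, M w⟫

/-- convexity of a function with values in `ℝ ∪ {±∞}`. -/
def ERConvex {E : Type*} [AddCommGroup E] [Module ℝ E] (p : E → EReal) : Prop :=
  ∀ x y : E, ∀ a b : ℝ, 0 ≤ a → 0 ≤ b → a + b = 1 →
    p (a • x + b • y) ≤ (a : EReal) * p x + (b : EReal) * p y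

/-- properness of a function with values in `ℝ ∪ {±∞}`: nowhere `−∞`, somewhere finite. -/
def ERProper {E : Type*} (p : E → EReal) : Prop :=
  (∃ x, p x ≠ ⊤) ∧ ∀ x, p x ≠ ⊥

/-- `g` belongs to the convex subdifferential `∂p(x)`. -/
def ERSubgrad {E : Type*} [NormedAddCommGroup E] [InnerProductSpace ℝ E]
    (p : E → EReal) (x g : E) : Prop :=
  ∀ w, p x + ((⟪g, w - x⟫ : ℝ) : EReal) ≤ p w

/-- the set `Ω̄` of KKT points of the problem `min p(y) + f(y) + q(z) + g(z)`
subject to `𝒜*y + ℬ*z = c`. -/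
def KKTset {X Y Z : Type*}
    [NormedAddCommGroup X] [InnerProductSpace ℝ X] [FiniteDimensional ℝ X]
    [NormedAddCommGroup Y] [InnerProductSpace ℝ Y] [FiniteDimensional ℝ Y]
    [NormedAddCommGroup Z] [InnerProductSpace ℝ Z] [FiniteDimensional ℝ Z]
    (A : X →ₗ[ℝ] Y) (B : X →ₗ[ℝ] Z) (c : X)
    (gradf : Y → Y) (gradg : Z → Z) (p : Y → EReal) (q : Z → EReal) :
    Set (Y × Z × X) :=
  {u | ERSubgrad p u.1 (-(gradf u.1 + A u.2.2)) ∧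
       ERSubgrad q u.2.1 (-(gradg u.2.1 + B u.2.2)) ∧
       LinearMap.adjoint A u.1 + LinearMap.adjoint B u.2.1 = c}

section QuadForm

variable {E : Type*} [NormedAddCommGroup E] [InnerProductSpace ℝ E]

lemma quadForm_add_op (M N : E →ₗ[ℝ] E) (w : E) :
    quadForm (M + N) w = quadForm M w + quadForm N w := by
  simp [quadForm, inner_add_right]

lemma quadForm_smul_op (a : ℝ) (M : E →ₗ[ℝ] E) (w : E) :
    quadForm (a • M) w = a * quadForm M w := by
  simp [quadForm, inner_smul_right]

lemma quadForm_smul (M : E →ₗ[ℝ] E) (a : ℝ) (w : E) :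
    quadForm M (a • w) = a ^ 2 * quadForm M w := by
  simp only [quadForm, map_smul, inner_smul_right, real_inner_smul_left]
  ring

lemma quadForm_add {M : E →ₗ[ℝ] E} (hM : M.IsSymmetric) (v w : E) :
    quadForm M (v + w) = quadForm M v + 2 * ⟪w, M v⟫ + quadForm M w := by
  have h : ⟪v, M w⟫ = ⟪w, M v⟫ := by rw [← hM v w, real_inner_comm]
  simp only [quadForm, map_add, inner_add_left, inner_add_right, h]
  ring

lemma quadForm_sub {M : E →ₗ[ℝ] E} (hM : M.IsSymmetric) (v w : E) :
    quadForm M (v - w) = quadForm M v - 2 * ⟪v, M w⟫ + quadForm M w := by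
  have h : ⟪w, M v⟫ = ⟪v, M w⟫ := by rw [← hM w v, real_inner_comm]
  simp only [quadForm, map_sub, inner_sub_left, inner_sub_right, h]
  ring

/-- Three-point identity for the quadratic form of a symmetric operator. -/
lemma quadForm_three_point {M : E →ₗ[ℝ] E} (hM : M.IsSymmetric) (u v w : E) :
    quadForm M (u - w) - quadForm M (v - w)
      = quadForm M (v - u) - 2 * ⟪v - w, M (v - u)⟫ := by
  have h := quadForm_sub hM (v - w) (v - u)
  rw [sub_sub_sub_cancel_left] at h
  linarith

lemma quadForm_comp_adjoint {X : Type*} [NormedAddCommGroup X] [InnerProductSpace ℝ X]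
    [FiniteDimensional ℝ X] [FiniteDimensional ℝ E] (B : X →ₗ[ℝ] E) (w : E) :
    quadForm (B ∘ₗ LinearMap.adjoint B) w = ‖LinearMap.adjoint B w‖ ^ 2 := by
  rw [quadForm, LinearMap.comp_apply, ← LinearMap.adjoint_inner_left, real_inner_self_eq_norm_sq]

/-- The gradient of a convex function majorized by `M` is cocoercive up to a quarter of `M`. -/
lemma inner_gradient_sub_ge {f : E → ℝ} {f' : E → E} {M : E →ₗ[ℝ] E}
    (hlow : ∀ w w', f w' + ⟪f' w', w - w'⟫ ≤ f w)
    (hupp : ∀ w w', f w ≤ f w' + ⟪f' w', w - w'⟫ + 1 / 2 * quadForm M (w - w'))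
    (u v w : E) :
    -(1 / 4) * quadForm M (w - u) ≤ ⟪f' u - f' v, w - v⟫ := by
  set h : E := (1 / 2 : ℝ) • (w - u) with hh
  have hw : w - v = (u - v) + (2 : ℝ) • h := by
    rw [hh, smul_smul]
    norm_num
  have hq : quadForm M h = 1 / 4 * quadForm M (w - u) := by
    rw [hh, quadForm_smul]
    norm_num
  have hqn : quadForm M (-h) = quadForm M h := by simp [quadForm]
  have h₁ := hlow (u + h) v
  have h₂ := hupp (u + h) u
  have h₃ := hlow (v - h) u
  have h₄ := hupp (v - h) v
  rw [add_sub_cancel_left] at h₂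
  rw [sub_sub_cancel_left, hqn] at h₄
  rw [hw]
  simp only [inner_add_right, inner_sub_right, inner_sub_left, inner_smul_right,
    inner_neg_right] at *
  linarith

/-- A minimizer of a convex function plus a smooth perturbation satisfies the first-order
condition, where `G` and `C` are the first- and second-order coefficients along the segment. -/
lemma toReal_le_add_of_isMin {p : E → EReal} (hconv : ERConvex p) (hbot : ∀ w, p w ≠ ⊥)
    {Q : E → ℝ} {v w : E} (hv : p v ≠ ⊤) (hw : p w ≠ ⊤)
    (hmin : ∀ w, p v + (Q v : EReal) ≤ p w + (Q w : EReal)) {G C : ℝ}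
    (hQ : ∀ t : ℝ, Q (v + t • (w - v)) = Q v + t * G + t ^ 2 * C) :
    (p v).toReal ≤ (p w).toReal + G := by
  have hpv := EReal.coe_toReal hv (hbot v)
  have hpw := EReal.coe_toReal hw (hbot w)
  have key : ∀ t : ℝ, 0 < t → t ≤ 1 → (p v).toReal ≤ (p w).toReal + G + t * C := by
    intro t ht ht1
    have hc := hconv v w (1 - t) t (by linarith) ht.le (by ring)
    have he : (1 - t) • v + t • w = v + t • (w - v) := by module
    rw [he] at hc
    have hm := (hmin (v + t • (w - v))).trans (add_le_add_left hc _)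
    rw [hQ, ← hpv, ← hpw] at hm
    norm_cast at hm
    have : t * (p v).toReal ≤ t * ((p w).toReal + G + t * C) := by linarith
    exact le_of_mul_le_mul_left this ht
  refine le_of_forall_pos_le_add fun ε hε => ?_
  have hC : 0 < |C| + 1 := by positivity
  have ht : 0 < min 1 (ε / (|C| + 1)) := lt_min one_pos (by positivity)
  have hk := key _ ht (min_le_left _ _)
  have h₁ : min 1 (ε / (|C| + 1)) * C ≤ ε := by
    calc min 1 (ε / (|C| + 1)) * C ≤ min 1 (ε / (|C| + 1)) * (|C| + 1) := by
          gcongr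
          linarith [le_abs_self C]
      _ ≤ ε / (|C| + 1) * (|C| + 1) := by
          gcongr
          exact min_le_right _ _
      _ = ε := by field_simp
  linarith

/-- First-order optimality condition of a proximal augmented Lagrangian subproblem. -/
lemma toReal_le_of_isMin_prox {X : Type*} [NormedAddCommGroup X] [InnerProductSpace ℝ X]
    [FiniteDimensional ℝ X] [FiniteDimensional ℝ E] {p : E → EReal} (hconv : ERConvex p)
    (hbot : ∀ w, p w ≠ ⊥) (A : X →ₗ[ℝ] E) {M : E →ₗ[ℝ] E} (hM : M.IsSymmetric) (d u : E)
    (σ : ℝ) (ρ : E → X) (hρ : ∀ w w', ρ w' = ρ w + LinearMap.adjoint A (w' - w))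
    {v w : E} (hv : p v ≠ ⊤) (hw : p w ≠ ⊤)
    (hmin : ∀ w, p v + ((⟪v, d⟫ + σ / 2 * ‖ρ v‖ ^ 2 + 1 / 2 * quadForm M (v - u) : ℝ) : EReal)
      ≤ p w + ((⟪w, d⟫ + σ / 2 * ‖ρ w‖ ^ 2 + 1 / 2 * quadForm M (w - u) : ℝ) : EReal)) :
    (p v).toReal ≤ (p w).toReal
      + (⟪w - v, d⟫ + σ * ⟪LinearMap.adjoint A (w - v), ρ v⟫ + ⟪w - v, M (v - u)⟫) := by
  refine toReal_le_add_of_isMin (Q := fun w => ⟪w, d⟫ + σ / 2 * ‖ρ w‖ ^ 2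
    + 1 / 2 * quadForm M (w - u)) hconv hbot hv hw hmin
    (C := σ / 2 * ‖LinearMap.adjoint A (w - v)‖ ^ 2 + 1 / 2 * quadForm M (w - v)) fun t => ?_
  have h₁ : v + t • (w - v) - u = (v - u) + t • (w - v) := by module
  have h₂ : ρ (v + t • (w - v)) = ρ v + t • LinearMap.adjoint A (w - v) := by
    rw [hρ v, add_sub_cancel_left, map_smul]
  simp only [h₁, h₂, quadForm_add hM, quadForm_smul, norm_add_sq_real, norm_smul, mul_pow,
    Real.norm_eq_abs, sq_abs, inner_add_left, real_inner_smul_left, inner_smul_right]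
  rw [real_inner_comm (ρ v)]
  ring

lemma ERSubgrad.ne_top {p : E → EReal} {v d w : E} (h : ERSubgrad p v d) (hw : p w ≠ ⊤) :
    p v ≠ ⊤ := by
  intro hv
  have := h w
  rw [hv, EReal.top_add_coe, top_le_iff] at this
  exact hw this

lemma ERSubgrad.toReal_le {p : E → EReal} (hbot : ∀ w, p w ≠ ⊥) {v d w : E}
    (h : ERSubgrad p v d) (hw : p w ≠ ⊤) : (p v).toReal + ⟪d, w - v⟫ ≤ (p w).toReal := by
  have hs := h w
  rw [← EReal.coe_toReal (h.ne_top hw) (hbot v), ← EReal.coe_toReal hw (hbot w)] at hs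
  exact_mod_cast hs

/-- Descent of the distance to a KKT point in one block of variables. -/
lemma block_descent {X : Type*} [NormedAddCommGroup X] [InnerProductSpace ℝ X]
    [FiniteDimensional ℝ X] [FiniteDimensional ℝ E] (A : X →ₗ[ℝ] E) {M S : E →ₗ[ℝ] E}
    (hMS : (M + S).IsSymmetric) {f' : E → E} {u v vbar : E} {x xbar ρ : X} {σ a abar : ℝ}
    (hopt : a ≤ abar + (⟪vbar - v, f' u + A x⟫ + σ * ⟪LinearMap.adjoint A (vbar - v), ρ⟫
      + ⟪vbar - v, (M + S) (v - u)⟫))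
    (hsub : abar + ⟪-(f' vbar + A xbar), v - vbar⟫ ≤ a)
    (hgrad : -(1 / 4) * quadForm M (v - u) ≤ ⟪f' u - f' vbar, v - vbar⟫) :
    quadForm ((1 / 2 : ℝ) • M + S) (v - u) + 2 * ⟪LinearMap.adjoint A (v - vbar), x - xbar⟫
        + 2 * σ * ⟪LinearMap.adjoint A (v - vbar), ρ⟫
      ≤ quadForm (M + S) (u - vbar) - quadForm (M + S) (v - vbar) := by
  rw [quadForm_three_point hMS, quadForm_add_op, quadForm_add_op, quadForm_smul_op,
    LinearMap.adjoint_inner_left, map_sub A]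
  rw [← neg_sub v vbar, map_neg] at hopt
  rw [real_inner_comm] at hsub hgrad
  generalize v - vbar = w at *
  simp only [inner_neg_left, inner_neg_right, inner_add_right, inner_sub_right] at *
  linarith

/-- Comparison of the optimality conditions of two successive subproblems in one block. -/
lemma successive_step_bound {X : Type*} [NormedAddCommGroup X] [InnerProductSpace ℝ X]
    [FiniteDimensional ℝ X] [FiniteDimensional ℝ E] (B : X →ₗ[ℝ] E) {M T : E →ₗ[ℝ] E}
    (hMT : (M + T).IsSymmetric) (hT : ∀ w, -(1 / 2) * quadForm M w ≤ quadForm T w)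
    {g' : E → E} {z₀ z₁ z₂ : E} {x₀ x₁ r₁ r₂ : X} {σ τ a₁ a₂ : ℝ}
    (hopt₂ : a₂ ≤ a₁ + (⟪z₁ - z₂, g' z₁ + B x₁⟫ + σ * ⟪LinearMap.adjoint B (z₁ - z₂), r₂⟫
      + ⟪z₁ - z₂, (M + T) (z₂ - z₁)⟫))
    (hopt₁ : a₁ ≤ a₂ + (⟪z₂ - z₁, g' z₀ + B x₀⟫ + σ * ⟪LinearMap.adjoint B (z₂ - z₁), r₁⟫
      + ⟪z₂ - z₁, (M + T) (z₁ - z₀)⟫))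
    (hx : x₁ = x₀ + (τ * σ) • r₁)
    (hgrad : -(1 / 4) * quadForm M ((z₂ - z₁) - (z₁ - z₀)) ≤ ⟪g' z₁ - g' z₀, z₂ - z₁⟫) :
    quadForm (M + T) (z₂ - z₁) - quadForm (M + T) (z₁ - z₀)
        - 2 * (1 - τ) * σ * ⟪LinearMap.adjoint B (z₂ - z₁), r₁⟫
      ≤ -2 * σ * ⟪LinearMap.adjoint B (z₂ - z₁), r₂⟫ := by
  have hq := quadForm_sub hMT (z₂ - z₁) (z₁ - z₀)
  have hT' := hT ((z₂ - z₁) - (z₁ - z₀))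
  have hB : ⟪z₂ - z₁, B r₁⟫ = ⟪LinearMap.adjoint B (z₂ - z₁), r₁⟫ :=
    (LinearMap.adjoint_inner_left B _ _).symm
  have hs : ⟪z₂ - z₁, (M + T) (z₂ - z₁)⟫ = quadForm (M + T) (z₂ - z₁) := rfl
  rw [quadForm_add_op M T (z₂ - z₁ - (z₁ - z₀))] at hq
  rw [hx, map_add, map_smul, ← neg_sub z₂ z₁, map_neg] at hopt₂
  rw [real_inner_comm] at hgrad
  generalize z₂ - z₁ = w at *
  simp only [inner_neg_left, inner_add_right, inner_sub_right, inner_smul_right, hB, hs] at *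
  linarith

end QuadForm

/-- The scalar estimate that absorbs the cross term between the previous residual `r` and the
current step `b`. -/
lemma dual_step_cross_term_nonneg {X : Type*} [NormedAddCommGroup X] [InnerProductSpace ℝ X]
    {τ : ℝ} (hτ : 0 < τ) (r b : X) :
    0 ≤ (1 - (1 - τ + min τ τ⁻¹) * τ) * ‖b‖ ^ 2 - 2 * (1 - τ) * ⟪r, b⟫
      + (1 - min τ τ⁻¹) * ‖r‖ ^ 2 := by
  rcases le_total τ 1 with h | h
  · rw [min_eq_left (h.trans ((one_le_inv₀ hτ).2 h))]
    have := mul_nonneg (sub_nonneg.2 h) (sq_nonneg ‖r - b‖)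
    rw [norm_sub_sq_real] at this
    linarith
  · rw [min_eq_right ((inv_le_one_of_one_le₀ h).trans h)]
    have := mul_nonneg (sub_nonneg.2 (inv_le_one_of_one_le₀ h)) (sq_nonneg ‖r + τ • b‖)
    rw [norm_add_sq_real, norm_smul, inner_smul_right, Real.norm_eq_abs, mul_pow, sq_abs] at this
    have hinv : τ⁻¹ * τ = 1 := inv_mul_cancel₀ hτ.ne'
    linear_combination this + ((1 - τ) * ‖b‖ ^ 2 - 2 * ⟪r, b⟫) * hinv

/-- **Lemma 3.4.**  For a sequence generated by the majorized iPADMM, any KKT point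
`(ȳ, z̄, x̄)` and every `k ≥ 1`, with
`φ_k := (τσ)⁻¹‖x^k − x̄‖² + ‖y^k − ȳ‖²_{Σ̂_f+𝒮} + ‖z^k − z̄‖²_{Σ̂_g+𝒯+σℬℬ*}` and
`t_{k+1} := ‖y^{k+1} − y^k‖²_{ℋ_f} + ‖z^{k+1} − z^k‖²_{ℋ_g}`:
`[φ_k + (1 − min(τ,τ⁻¹))σ‖r^k‖² + ‖z^k − z^{k−1}‖²_{Σ̂_g+𝒯}]
  − [φ_{k+1} + (1 − min(τ,τ⁻¹))σ‖r^{k+1}‖² + ‖z^{k+1} − z^k‖²_{Σ̂_g+𝒯}]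
  ≥ t_{k+1} + (−τ + min(1+τ, 1+τ⁻¹))σ‖r^{k+1}‖²`. -/
theorem stmt4 {X Y Z : Type*}
    [NormedAddCommGroup X] [InnerProductSpace ℝ X] [FiniteDimensional ℝ X]
    [NormedAddCommGroup Y] [InnerProductSpace ℝ Y] [FiniteDimensional ℝ Y]
    [NormedAddCommGroup Z] [InnerProductSpace ℝ Z] [FiniteDimensional ℝ Z]
    (A : X →ₗ[ℝ] Y) (B : X →ₗ[ℝ] Z) (c : X)
    (f : Y → ℝ) (g : Z → ℝ) (gradf : Y → Y) (gradg : Z → Z)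
    (hfconv : ConvexOn ℝ Set.univ f) (hgconv : ConvexOn ℝ Set.univ g)
    (hfdiff : ∀ w, HasGradientAt f (gradf w) w)
    (hgdiff : ∀ w, HasGradientAt g (gradg w) w)
    (hfLip : ∃ L : NNReal, LipschitzWith L gradf)
    (hgLip : ∃ L : NNReal, LipschitzWith L gradg)
    (p : Y → EReal) (q : Z → EReal)
    (hpconv : ERConvex p) (hplsc : LowerSemicontinuous p) (hpproper : ERProper p)
    (hqconv : ERConvex q) (hqlsc : LowerSemicontinuous q) (hqproper : ERProper q)
    (Sf Sfh : Y →ₗ[ℝ] Y) (Sg Sgh : Z →ₗ[ℝ] Z)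
    (hSfsym : Sf.IsSymmetric) (hSfh_sym : Sfh.IsSymmetric)
    (hSgsym : Sg.IsSymmetric) (hSghsym : Sgh.IsSymmetric)
    (hSfpos : ∀ w, 0 ≤ quadForm Sf w) (hSfhpos : ∀ w, 0 ≤ quadForm Sfh w)
    (hSgpos : ∀ w, 0 ≤ quadForm Sg w) (hSghpos : ∀ w, 0 ≤ quadForm Sgh w)
    (hSfle : ∀ w, quadForm Sf w ≤ quadForm Sfh w)
    (hSgle : ∀ w, quadForm Sg w ≤ quadForm Sgh w)
    (hfmaj : ∀ w w' : Y,
      f w' + ⟪gradf w', w - w'⟫ + 1 / 2 * quadForm Sf (w - w') ≤ f w ∧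
      f w ≤ f w' + ⟪gradf w', w - w'⟫ + 1 / 2 * quadForm Sfh (w - w'))
    (hgmaj : ∀ w w' : Z,
      g w' + ⟪gradg w', w - w'⟫ + 1 / 2 * quadForm Sg (w - w') ≤ g w ∧
      g w ≤ g w' + ⟪gradg w', w - w'⟫ + 1 / 2 * quadForm Sgh (w - w'))
    (σ τ : ℝ) (hσ : 0 < σ) (hτ : 0 < τ)
    (S : Y →ₗ[ℝ] Y) (T : Z →ₗ[ℝ] Z)
    (hSsym : S.IsSymmetric) (hTsym : T.IsSymmetric)
    (hS : ∀ w, -(1 / 2) * quadForm Sfh w ≤ quadForm S w)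
    (hT : ∀ w, -(1 / 2) * quadForm Sgh w ≤ quadForm T w)
    (y : ℕ → Y) (z : ℕ → Z) (x : ℕ → X)
    (hdomp : ∀ k, p (y k) ≠ ⊤) (hdomq : ∀ k, q (z k) ≠ ⊤)
    (hsubY : ∀ k, ∀ w : Y,
      p (y (k + 1)) + ((⟪y (k + 1), gradf (y k) + A (x k)⟫
          + σ / 2 * ‖LinearMap.adjoint A (y (k + 1)) + LinearMap.adjoint B (z k) - c‖ ^ 2
          + 1 / 2 * quadForm (Sfh + S) (y (k + 1) - y k) : ℝ) : EReal)
      ≤ p w + ((⟪w, gradf (y k) + A (x k)⟫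
          + σ / 2 * ‖LinearMap.adjoint A w + LinearMap.adjoint B (z k) - c‖ ^ 2
          + 1 / 2 * quadForm (Sfh + S) (w - y k) : ℝ) : EReal))
    (hsubZ : ∀ k, ∀ w : Z,
      q (z (k + 1)) + ((⟪z (k + 1), gradg (z k) + B (x k)⟫
          + σ / 2 * ‖LinearMap.adjoint A (y (k + 1)) + LinearMap.adjoint B (z (k + 1)) - c‖ ^ 2
          + 1 / 2 * quadForm (Sgh + T) (z (k + 1) - z k) : ℝ) : EReal)
      ≤ q w + ((⟪w, gradg (z k) + B (x k)⟫
          + σ / 2 * ‖LinearMap.adjoint A (y (k + 1)) + LinearMap.adjoint B w - c‖ ^ 2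
          + 1 / 2 * quadForm (Sgh + T) (w - z k) : ℝ) : EReal))
    (hxup : ∀ k, x (k + 1)
      = x k + (τ * σ) • (LinearMap.adjoint A (y (k + 1)) + LinearMap.adjoint B (z (k + 1)) - c))
    (hKKTne : (KKTset A B c gradf gradg p q).Nonempty)
    (ybar : Y) (zbar : Z) (xbar : X)
    (hKKT : (ybar, zbar, xbar) ∈ KKTset A B c gradf gradg p q) :
    ∀ k : ℕ, 1 ≤ k →
      let φ : ℕ → ℝ := fun j =>
        (τ * σ)⁻¹ * ‖x j - xbar‖ ^ 2 + quadForm (Sfh + S) (y j - ybar)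
          + quadForm (Sgh + T + σ • (B ∘ₗ LinearMap.adjoint B)) (z j - zbar)
      let r : ℕ → X := fun j =>
        LinearMap.adjoint A (y j) + LinearMap.adjoint B (z j) - c
      let tτ : ℝ := (1 - τ + min τ τ⁻¹) / 2
      quadForm ((1 / 2 : ℝ) • Sfh + S) (y (k + 1) - y k)
        + quadForm ((1 / 2 : ℝ) • Sgh + T + (2 * tτ * τ * σ) • (B ∘ₗ LinearMap.adjoint B))
            (z (k + 1) - z k)
        + (-τ + min (1 + τ) (1 + τ⁻¹)) * σ * ‖r (k + 1)‖ ^ 2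
      ≤ (φ k + (1 - min τ τ⁻¹) * σ * ‖r k‖ ^ 2 + quadForm (Sgh + T) (z k - z (k - 1)))
        - (φ (k + 1) + (1 - min τ τ⁻¹) * σ * ‖r (k + 1)‖ ^ 2
            + quadForm (Sgh + T) (z (k + 1) - z k)) := by
  intro k hk φ r tτ
  obtain ⟨j, rfl⟩ : ∃ j, k = j + 1 := ⟨k - 1, by omega⟩
  obtain ⟨hKy, hKz, hKc⟩ := hKKT
  dsimp only at hKy hKz hKc
  have hMf : (Sfh + S).IsSymmetric := hSfh_sym.add hSsym
  have hMg : (Sgh + T).IsSymmetric := hSghsym.add hTsym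
  have hy := toReal_le_of_isMin_prox hpconv hpproper.2 A hMf (gradf (y (j + 1)) + A (x (j + 1)))
    (y (j + 1)) σ (fun w => LinearMap.adjoint A w + LinearMap.adjoint B (z (j + 1)) - c)
    (fun w w' => by simp only [map_sub]; abel) (hdomp (j + 1 + 1)) (hKy.ne_top (hdomp 0))
    (hsubY (j + 1))
  have hz := fun (i : ℕ) (w : Z) (hw : q w ≠ ⊤) =>
    toReal_le_of_isMin_prox hqconv hqproper.2 B hMg (gradg (z i) + B (x i))
      (z i) σ (fun w => LinearMap.adjoint A (y (i + 1)) + LinearMap.adjoint B w - c)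
      (fun w w' => by simp only [map_sub]; abel) (hdomq (i + 1)) hw (hsubZ i)
  have hz₁ := hz (j + 1) _ (hKz.ne_top (hdomq 0))
  have hz₂ := hz (j + 1) _ (hdomq (j + 1))
  have hz₃ := hz j _ (hdomq (j + 1 + 1))
  have hyb := hKy.toReal_le hpproper.2 (hdomp (j + 1 + 1))
  have hzb := hKz.toReal_le hqproper.2 (hdomq (j + 1 + 1))
  have hflow : ∀ w w', f w' + ⟪gradf w', w - w'⟫ ≤ f w := fun w w' => by
    linarith [(hfmaj w w').1, hSfpos (w - w')]
  have hglow : ∀ w w', g w' + ⟪gradg w', w - w'⟫ ≤ g w := fun w w' => by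
    linarith [(hgmaj w w').1, hSgpos (w - w')]
  have hf₁ := inner_gradient_sub_ge hflow (fun w w' => (hfmaj w w').2)
    (y (j + 1)) ybar (y (j + 1 + 1))
  have hg₁ := inner_gradient_sub_ge hglow (fun w w' => (hgmaj w w').2)
    (z (j + 1)) zbar (z (j + 1 + 1))
  have hg₂ := inner_gradient_sub_ge hglow (fun w w' => (hgmaj w w').2)
    (z (j + 1)) (z j) (z j + (z (j + 1 + 1) - z (j + 1)))
  have hr : ∀ i, LinearMap.adjoint A (y i) + LinearMap.adjoint B (z i) - c = r i := fun _ => rfl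
  have hx₁ := hxup (j + 1)
  have hx₀ := hxup j
  rw [hr] at hx₁ hx₀
  simp only [hr] at hz₁ hz₂ hz₃
  rw [add_sub_cancel_left, show z j + (z (j + 1 + 1) - z (j + 1)) - z (j + 1)
    = (z (j + 1 + 1) - z (j + 1)) - (z (j + 1) - z j) by abel] at hg₂
  have hY := block_descent A hMf hy hyb hf₁
  have hZ := block_descent B hMg hz₁ hzb hg₁
  have hW := successive_step_bound B hMg hT hz₂ hz₃ hx₀ hg₂
  have hV := mul_nonneg hσ.le
    (dual_step_cross_term_nonneg hτ (r (j + 1)) (LinearMap.adjoint B (z (j + 1 + 1) - z (j + 1))))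
  have hmin : min (1 + τ) (1 + τ⁻¹) = 1 + min τ τ⁻¹ := min_add_add_left _ _ _
  have hX : (τ * σ)⁻¹ * ‖x (j + 1 + 1) - xbar‖ ^ 2 = (τ * σ)⁻¹ * ‖x (j + 1) - xbar‖ ^ 2
      + 2 * ⟪r (j + 1 + 1), x (j + 1) - xbar⟫ + τ * σ * ‖r (j + 1 + 1)‖ ^ 2 := by
    rw [hx₁, add_sub_right_comm, norm_add_sq_real, norm_smul, inner_smul_right, mul_pow,
      Real.norm_eq_abs, sq_abs, real_inner_comm]
    field_simp
  have hAe : LinearMap.adjoint A (y (j + 1 + 1) - ybar)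
      = r (j + 1 + 1) - LinearMap.adjoint B (z (j + 1 + 1) - zbar) := by
    rw [← hr, ← hKc, map_sub, map_sub]
    abel
  have hry : LinearMap.adjoint A (y (j + 1 + 1)) + LinearMap.adjoint B (z (j + 1)) - c
      = r (j + 1 + 1) - LinearMap.adjoint B (z (j + 1 + 1) - z (j + 1)) := by
    rw [← hr, map_sub]
    abel
  have hBe : LinearMap.adjoint B (z (j + 1) - zbar) = LinearMap.adjoint B (z (j + 1 + 1) - zbar)
      - LinearMap.adjoint B (z (j + 1 + 1) - z (j + 1)) := by
    rw [← map_sub, sub_sub_sub_cancel_left]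
  rw [hAe, hry] at hY
  simp only [φ, tτ, hmin, Nat.add_sub_cancel]
  rw [quadForm_add_op (Sgh + T), quadForm_add_op (Sgh + T), quadForm_add_op ((1 / 2 : ℝ) • Sgh + T),
    quadForm_smul_op, quadForm_smul_op, quadForm_smul_op, quadForm_comp_adjoint,
    quadForm_comp_adjoint, quadForm_comp_adjoint, hX, hBe]
  generalize LinearMap.adjoint B (z (j + 1 + 1) - z (j + 1)) = b at *
  generalize LinearMap.adjoint B (z (j + 1 + 1) - zbar) = e at *
  generalize x (j + 1) - xbar = d at *
  generalize r (j + 1 + 1) = r₂ at *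
  generalize r (j + 1) = r₁ at *
  rw [real_inner_comm b] at hV
  simp only [inner_sub_left, inner_sub_right, real_inner_self_eq_norm_sq] at hY
  rw [real_inner_comm r₂ b] at hW
  rw [norm_sub_sq_real e b]
  linarith

end
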